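/- Maximal deviation bound for subsampled minibatch UOT: under the setting of the two previous statements (bounded kernel h ∈ [0,M], n iid samples from each of α, β, k uniform random minibatch pairs of size m), for any δ ∈ (0,1), with probability at least 1−δ, |h̃_k^m(X,Y) − E_h| ≤ M ( √(log(2/δ)/(2⌊n/m⌋)) + √(2 log(2/δ)/k) ). -/

import Mathlib

open scoped BigOperators
open MeasureTheory

instance embMeasurableSpace (n m : ℕ) : MeasurableSpace (Fin m ↪ Fin n) := ⊤

open ProbabilityTheory in
/-- Hoeffding's lemma for the centred empirical mean of an iid bounded sample. -/
lemma hasSubgaussianMGF_mean_sub_integral {Ω ι : Type*} [MeasurableSpace Ω] [Fintype ι]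
    [Nonempty ι] (μ : Measure Ω) [IsProbabilityMeasure μ] {g : Ω → ℝ} {M : NNReal}
    (hg : Measurable g) (hb : ∀ x, g x ∈ Set.Icc 0 (M : ℝ)) :
    HasSubgaussianMGF (fun ω : ι → Ω => 1 / (Fintype.card ι : ℝ) * ∑ i, g (ω i) - ∫ x, g x ∂μ)
      (M ^ 2 / (4 * Fintype.card ι)) (Measure.pi fun _ => μ) := by
  have h1 : HasSubgaussianMGF (fun x => g x - ∫ x, g x ∂μ) ((‖(M : ℝ) - 0‖₊ / 2) ^ 2) μ :=
    hasSubgaussianMGF_of_mem_Icc hg.aemeasurable (ae_of_all _ hb)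
  have h2 : ∀ i ∈ (Finset.univ : Finset ι), HasSubgaussianMGF
      (fun ω : ι → Ω => g (ω i) - ∫ x, g x ∂μ) ((‖(M : ℝ) - 0‖₊ / 2) ^ 2)
      (Measure.pi fun _ => μ) := by
    intro i _
    refine HasSubgaussianMGF.of_map (X := fun x => g x - ∫ x, g x ∂μ) (Y := fun ω : ι → Ω => ω i)
      (measurable_pi_apply i).aemeasurable ?_
    rwa [(measurePreserving_eval (fun _ : ι => μ) i).map_eq]
  have h3 : iIndepFun (fun i (ω : ι → Ω) => g (ω i) - ∫ x, g x ∂μ) (Measure.pi fun _ => μ) :=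
    iIndepFun_pi (X := fun _ x => g x - ∫ x, g x ∂μ)
      fun _ => (hg.sub_const _).aemeasurable
  have h4 := (HasSubgaussianMGF.sum_of_iIndepFun h3 h2).const_mul (1 / (Fintype.card ι : ℝ))
  have hk : (Fintype.card ι : ℝ) ≠ 0 := by simp
  convert h4 using 1
  · ext ω
    simp only [Finset.sum_sub_distrib, Finset.sum_const, Finset.card_univ, nsmul_eq_mul]
    field_simp
  · apply NNReal.eq
    change _ = (1 / (Fintype.card ι : ℝ)) ^ 2 *
      ((∑ _i : ι, (‖(M : ℝ) - 0‖₊ / 2) ^ 2 : NNReal) : ℝ)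
    simp only [sub_zero, Finset.sum_const, Finset.card_univ, nsmul_eq_mul, NNReal.nnnorm_eq]
    push_cast
    field_simp
    norm_num

open ProbabilityTheory in
/-- A mean of sub-Gaussian variables, not necessarily independent, is sub-Gaussian with the same
parameter. -/
lemma ProbabilityTheory.HasSubgaussianMGF.mean {Ω ι : Type*} [MeasurableSpace Ω] [Fintype ι] [Nonempty ι]
    {μ : Measure Ω} {X : ι → Ω → ℝ} {c : NNReal} (hX : ∀ i, HasSubgaussianMGF (X i) c μ) :
    HasSubgaussianMGF (fun ω => (∑ i, X i ω) / Fintype.card ι) c μ := by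
  have hk : (Fintype.card ι : ℝ) ≠ 0 := by simp
  have hle : ∀ t ω, Real.exp (t * ((∑ i, X i ω) / Fintype.card ι))
      ≤ ∑ i, (1 / (Fintype.card ι : ℝ)) * Real.exp (t * X i ω) := by
    intro t ω
    have := convexOn_exp.map_sum_le (t := Finset.univ) (w := fun _ : ι => 1 / (Fintype.card ι : ℝ))
      (p := fun i => t * X i ω) (fun _ _ => by positivity) (by simp [hk]) (fun _ _ => trivial)
    have harg : t * ((∑ i, X i ω) / Fintype.card ι) =
        ∑ i, 1 / (Fintype.card ι : ℝ) * (t * X i ω) := by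
      rw [← Finset.mul_sum, ← Finset.mul_sum]
      ring
    rw [harg]
    simpa only [smul_eq_mul] using this
  have hint : ∀ t, Integrable
      (fun ω => ∑ i, (1 / (Fintype.card ι : ℝ)) * Real.exp (t * X i ω)) μ := fun t =>
    integrable_finsetSum _ fun i _ => ((hX i).integrable_exp_mul t).const_mul _
  have hint' : ∀ t, Integrable (fun ω => Real.exp (t * ((∑ i, X i ω) / Fintype.card ι))) μ := by
    intro t
    refine (hint t).mono' ?_ (ae_of_all _ fun ω => ?_)
    · have : AEMeasurable (fun ω => ∑ i, X i ω) μ :=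
        Finset.aemeasurable_fun_sum _ fun i _ => (hX i).aemeasurable
      exact (Real.measurable_exp.comp_aemeasurable
        ((this.div_const _).const_mul t)).aestronglyMeasurable
    · rw [Real.norm_eq_abs, Real.abs_exp]
      exact hle t ω
  refine ⟨hint', fun t => ?_⟩
  calc mgf (fun ω => (∑ i, X i ω) / Fintype.card ι) μ t
      ≤ ∫ ω, ∑ i, (1 / (Fintype.card ι : ℝ)) * Real.exp (t * X i ω) ∂μ :=
        integral_mono (hint' t) (hint t) (hle t)
    _ = ∑ i, (1 / (Fintype.card ι : ℝ)) * mgf (X i) μ t := by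
        rw [integral_finsetSum _ fun i _ => ((hX i).integrable_exp_mul t).const_mul _]
        simp only [integral_const_mul, mgf]
    _ ≤ ∑ _i : ι, (1 / (Fintype.card ι : ℝ)) * Real.exp (c * t ^ 2 / 2) := by
        gcongr with i
        exact (hX i).mgf_le t
    _ = Real.exp (c * t ^ 2 / 2) := by
        simp only [Finset.sum_const, Finset.card_univ, nsmul_eq_mul]
        field_simp

open ProbabilityTheory in
/-- Replacing a conditional expectation by an empirical mean of conditionally iid bounded draws
adds the parameters of the sub-Gaussian moment-generating functions. -/
lemma ProbabilityTheory.HasSubgaussianMGF.resample {Ω S ι : Type*} [MeasurableSpace Ω] [MeasurableSpace S]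
    [Fintype ι] [Nonempty ι] {P : Measure Ω} [IsProbabilityMeasure P] {ν : Measure S}
    [IsProbabilityMeasure ν] {G : Ω → S → ℝ} {M : NNReal}
    (hG : Measurable (Function.uncurry G)) (hb : ∀ ω s, G ω s ∈ Set.Icc 0 (M : ℝ))
    {e : ℝ} {c : NNReal} (hU : HasSubgaussianMGF (fun ω => (∫ s, G ω s ∂ν) - e) c P) :
    HasSubgaussianMGF (fun z : Ω × (ι → S) =>
        1 / (Fintype.card ι : ℝ) * ∑ i, G z.1 (z.2 i) - e)
      (c + M ^ 2 / (4 * Fintype.card ι)) (P.prod (Measure.pi fun _ => ν)) := by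
  have hk : (0 : ℝ) < Fintype.card ι := by simp [Fintype.card_pos]
  have hmeas : Measurable (fun z : Ω × (ι → S) =>
      1 / (Fintype.card ι : ℝ) * ∑ i, G z.1 (z.2 i) - e) := by
    refine ((Finset.measurable_fun_sum _ fun i _ => ?_).const_mul _).sub_const _
    exact hG.comp (measurable_fst.prodMk ((measurable_pi_apply i).comp measurable_snd))
  have hbd : ∀ z : Ω × (ι → S), 1 / (Fintype.card ι : ℝ) * ∑ i, G z.1 (z.2 i) - e
      ∈ Set.Icc (0 - e) (M - e) := by
    intro z
    have h0 : 0 ≤ ∑ i, G z.1 (z.2 i) := Finset.sum_nonneg fun i _ => (hb _ _).1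
    have h1 : ∑ i, G z.1 (z.2 i) ≤ Fintype.card ι * M := by
      simpa using Finset.sum_le_sum fun i (_ : i ∈ Finset.univ) => (hb z.1 (z.2 i)).2
    refine ⟨sub_le_sub_right (by positivity) _, sub_le_sub_right ?_ _⟩
    rw [one_div, inv_mul_le_iff₀ hk]
    exact h1
  have hint : ∀ t, Integrable (fun z : Ω × (ι → S) =>
      Real.exp (t * (1 / (Fintype.card ι : ℝ) * ∑ i, G z.1 (z.2 i) - e)))
      (P.prod (Measure.pi fun _ => ν)) := fun t =>
    integrable_exp_mul_of_mem_Icc hmeas.aemeasurable (ae_of_all _ hbd)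
  refine ⟨hint, fun t => ?_⟩
  have hin : ∀ ω, ∫ s : ι → S, Real.exp (t * (1 / (Fintype.card ι : ℝ) * ∑ i, G ω (s i) - e))
      ∂(Measure.pi fun _ => ν) ≤ Real.exp (t * ((∫ s, G ω s ∂ν) - e)) *
        Real.exp ((M ^ 2 / (4 * Fintype.card ι)) * t ^ 2 / 2) := by
    intro ω
    have h1 := (hasSubgaussianMGF_mean_sub_integral (ι := ι) ν
      (hG.of_uncurry_left (x := ω)) (hb ω)).mgf_le t
    have h2 : ∀ s : ι → S, Real.exp (t * (1 / (Fintype.card ι : ℝ) * ∑ i, G ω (s i) - e)) =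
        Real.exp (t * ((∫ s, G ω s ∂ν) - e)) *
          Real.exp (t * (1 / (Fintype.card ι : ℝ) * ∑ i, G ω (s i) - ∫ s, G ω s ∂ν)) := by
      intro s
      rw [← Real.exp_add]
      ring_nf
    simp only [h2, integral_const_mul]
    gcongr
    simpa [mgf] using h1
  calc mgf (fun z : Ω × (ι → S) => 1 / (Fintype.card ι : ℝ) * ∑ i, G z.1 (z.2 i) - e)
        (P.prod (Measure.pi fun _ => ν)) t
      = ∫ ω, ∫ s : ι → S, Real.exp (t * (1 / (Fintype.card ι : ℝ) * ∑ i, G ω (s i) - e))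
          ∂(Measure.pi fun _ => ν) ∂P := integral_prod _ (hint t)
    _ ≤ ∫ ω, Real.exp (t * ((∫ s, G ω s ∂ν) - e)) *
        Real.exp ((M ^ 2 / (4 * Fintype.card ι)) * t ^ 2 / 2) ∂P :=
        integral_mono (hint t).integral_prod_left ((hU.integrable_exp_mul t).mul_const _) hin
    _ ≤ Real.exp (c * t ^ 2 / 2) * Real.exp ((M ^ 2 / (4 * Fintype.card ι)) * t ^ 2 / 2) := by
        rw [integral_mul_const]
        gcongr
        exact hU.mgf_le t
    _ = _ := by
        rw [← Real.exp_add]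
        push_cast
        ring_nf

/-- The orbit average along a product of transitive finite group actions is the uniform average. -/
lemma sum_smul_smul_div_card {G H X Y : Type*} [Group G] [Group H] [MulAction G X] [MulAction H Y]
    [MulAction.IsPretransitive G X] [MulAction.IsPretransitive H Y]
    [Fintype G] [Fintype H] [Fintype X] [Fintype Y] (f : X × Y → ℝ) (x : X) (y : Y) :
    (∑ p : G × H, f (p.1 • x, p.2 • y)) / Fintype.card (G × H) =
      (∑ z, f z) / Fintype.card (X × Y) := by
  have : Nonempty (X × Y) := ⟨(x, y)⟩
  have hconst : ∀ z : X × Y,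
      ∑ p : G × H, f (p.1 • z.1, p.2 • z.2) = ∑ p : G × H, f (p.1 • x, p.2 • y) := by
    rintro ⟨x', y'⟩
    obtain ⟨g, rfl⟩ := MulAction.exists_smul_eq G x x'
    obtain ⟨k, rfl⟩ := MulAction.exists_smul_eq H y y'
    refine Fintype.sum_equiv (Equiv.mulRight (g, k)) _ _ fun p => ?_
    simp [mul_smul]
  have hswap : ∑ z : X × Y, ∑ p : G × H, f (p.1 • z.1, p.2 • z.2) =
      ∑ _p : G × H, ∑ z, f z := by
    rw [Finset.sum_comm]
    refine Finset.sum_congr rfl fun p _ => ?_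
    exact Fintype.sum_equiv ((MulAction.toPerm p.1).prodCongr (MulAction.toPerm p.2)) _ _
      fun _ => rfl
  simp only [hconst, Finset.sum_const, Finset.card_univ, nsmul_eq_mul] at hswap
  have h1 : (Fintype.card (X × Y) : ℝ) ≠ 0 := by
    exact_mod_cast Fintype.card_ne_zero
  have h2 : (Fintype.card (G × H) : ℝ) ≠ 0 := by
    exact_mod_cast Fintype.card_ne_zero
  rw [div_eq_div_iff h2 h1]
  linarith

open ProbabilityTheory in
/-- Regrouping distinct coordinates of an iid family into disjoint blocks gives iid blocks. -/
lemma measurePreserving_pi_blocks {E ι κ κ' : Type*} [MeasurableSpace E] [Fintype ι] [Fintype κ]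
    [Fintype κ'] (α : Measure E) [IsProbabilityMeasure α] {a : κ × κ' → ι}
    (ha : Function.Injective a) :
    MeasurePreserving (fun (x : ι → E) (q : κ) (i : κ') => x (a (q, i)))
      (Measure.pi fun _ => α) (Measure.pi fun _ => Measure.pi fun _ => α) := by
  have hind : iIndepFun (fun (i : ι) (x : ι → E) => x i) (Measure.pi fun _ => α) :=
    iIndepFun_pi (X := fun _ x => x) fun _ => aemeasurable_id
  have h1 : (Measure.pi fun _ : ι => α).map (fun x (p : κ × κ') => x (a p)) =
      Measure.pi fun _ => α := by
    rw [(hind.precomp ha).map_fun_eq_pi_map fun p => (measurable_pi_apply _).aemeasurable]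
    congr
    ext1 p
    exact (measurePreserving_eval (fun _ : ι => α) (a p)).map_eq
  have h2 := Measure.infinitePi_map_curry (X := E) fun (_ : κ) (_ : κ') => α
  simp only [Measure.infinitePi_eq_pi] at h2
  refine ⟨by fun_prop, ?_⟩
  rw [← h2, ← h1, Measure.map_map (MeasurableEquiv.measurable _) (by fun_prop)]
  rfl

/-- Tail bound from a sub-Gaussian moment-generating function, for the absolute value. -/
lemma ProbabilityTheory.HasSubgaussianMGF.measure_abs_ge_le {Ω : Type*} [MeasurableSpace Ω]
    {μ : Measure Ω} [IsFiniteMeasure μ] {X : Ω → ℝ} {c : NNReal} (h : HasSubgaussianMGF X c μ)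
    {ε : ℝ} (hε : 0 ≤ ε) :
    μ.real {ω | ε ≤ |X ω|} ≤ 2 * Real.exp (-ε ^ 2 / (2 * c)) := by
  have hsub : {ω | ε ≤ |X ω|} ⊆ {ω | ε ≤ X ω} ∪ {ω | ε ≤ (-X) ω} := fun ω (hω : ε ≤ |X ω|) =>
    show ε ≤ X ω ∨ ε ≤ -X ω from le_abs.mp hω
  calc μ.real {ω | ε ≤ |X ω|} ≤ μ.real ({ω | ε ≤ X ω} ∪ {ω | ε ≤ (-X) ω}) :=
        measureReal_mono hsub
    _ ≤ μ.real {ω | ε ≤ X ω} + μ.real {ω | ε ≤ (-X) ω} := measureReal_union_le _ _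
    _ ≤ 2 * Real.exp (-ε ^ 2 / (2 * c)) := by
        linarith [h.measure_ge_le hε, h.neg.measure_ge_le hε]

open ProbabilityTheory in
/-- Hoeffding's moment-generating function bound for the complete two-sample U-statistic. -/
lemma hasSubgaussianMGF_completeUStatistic {E F : Type*} [MeasurableSpace E] [MeasurableSpace F]
    (α : Measure E) (β : Measure F) [IsProbabilityMeasure α] [IsProbabilityMeasure β]
    {n m : ℕ} (hm : 1 ≤ m) (hmn : m ≤ n) {h : (Fin m → E) → (Fin m → F) → ℝ} {M : NNReal}
    (hmeas : Measurable (Function.uncurry h)) (hbd : ∀ x y, h x y ∈ Set.Icc 0 (M : ℝ)) :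
    HasSubgaussianMGF (fun ω : (Fin n → E) × (Fin n → F) =>
        (∑ z : (Fin m ↪ Fin n) × (Fin m ↪ Fin n),
          h (fun i => ω.1 (z.1 i)) (fun j => ω.2 (z.2 j))) /
            Fintype.card ((Fin m ↪ Fin n) × (Fin m ↪ Fin n)) -
        ∫ z, h z.1 z.2
          ∂((Measure.pi fun _ : Fin m => α).prod (Measure.pi fun _ : Fin m => β)))
      (M ^ 2 / (4 * (n / m : ℕ)))
      ((Measure.pi fun _ : Fin n => α).prod (Measure.pi fun _ : Fin n => β)) := by
  set e := ∫ z, h z.1 z.2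
    ∂((Measure.pi fun _ : Fin m => α).prod (Measure.pi fun _ : Fin m => β))
  have hP : 0 < n / m := Nat.div_pos hmn hm
  have : Nonempty (Fin (n / m)) := ⟨⟨0, hP⟩⟩
  have hPR : ((n / m : ℕ) : ℝ) ≠ 0 := by exact_mod_cast hP.ne'
  let a : Fin (n / m) × Fin m ↪ Fin n :=
    finProdFinEquiv.toEmbedding.trans (Fin.castLEEmb (Nat.div_mul_le_self n m))
  let b : Fin (n / m) → (Fin m ↪ Fin n) := fun q =>
    ⟨fun i => a (q, i), fun i j hij => (Prod.mk.inj (a.injective hij)).2⟩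
  let W : Equiv.Perm (Fin n) × Equiv.Perm (Fin n) → (Fin n → E) × (Fin n → F) → ℝ := fun p ω =>
    1 / ((n / m : ℕ) : ℝ) * (∑ q, h (fun i => ω.1 (p.1 (a (q, i))))
      (fun j => ω.2 (p.2 (a (q, j))))) - e
  have hW : ∀ p, HasSubgaussianMGF (W p) (M ^ 2 / (4 * (n / m : ℕ)))
      ((Measure.pi fun _ : Fin n => α).prod (Measure.pi fun _ : Fin n => β)) := by
    intro p
    have h1 := (measurePreserving_pi_blocks α (p.1.injective.comp a.injective)).prod
      (measurePreserving_pi_blocks β (p.2.injective.comp a.injective))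
    have h2 := (measurePreserving_arrowProdEquivProdArrow (Fin m → E) (Fin m → F) (Fin (n / m))
      (fun _ => Measure.pi fun _ => α) (fun _ => Measure.pi fun _ => β)).symm.comp h1
    have h3 := hasSubgaussianMGF_mean_sub_integral (ι := Fin (n / m))
      ((Measure.pi fun _ : Fin m => α).prod (Measure.pi fun _ : Fin m => β)) hmeas
      (fun z => hbd z.1 z.2)
    rw [← h2.map_eq] at h3
    have h4 := HasSubgaussianMGF.of_map h2.measurable.aemeasurable h3
    rw [Fintype.card_fin] at h4
    exact h4
  convert HasSubgaussianMGF.mean hW using 1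
  ext ω
  have havg : ∀ q, (∑ p : Equiv.Perm (Fin n) × Equiv.Perm (Fin n),
      h (fun i => ω.1 (p.1 (a (q, i)))) (fun j => ω.2 (p.2 (a (q, j))))) /
        Fintype.card (Equiv.Perm (Fin n) × Equiv.Perm (Fin n)) =
      (∑ z : (Fin m ↪ Fin n) × (Fin m ↪ Fin n),
          h (fun i => ω.1 (z.1 i)) (fun j => ω.2 (z.2 j))) /
            Fintype.card ((Fin m ↪ Fin n) × (Fin m ↪ Fin n)) := by
    intro q
    have : MulAction.IsPretransitive (Equiv.Perm (Fin n)) (Fin m ↪ Fin n) :=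
      Equiv.Perm.isMultiplyPretransitive (Fin n) m
    exact sum_smul_smul_div_card (G := Equiv.Perm (Fin n)) (H := Equiv.Perm (Fin n))
      (fun z : (Fin m ↪ Fin n) × (Fin m ↪ Fin n) =>
        h (fun i => ω.1 (z.1 i)) (fun j => ω.2 (z.2 j))) (b q) (b q)
  have hc : (Fintype.card (Equiv.Perm (Fin n) × Equiv.Perm (Fin n)) : ℝ) ≠ 0 := by
    exact_mod_cast Fintype.card_ne_zero
  simp only [W, Finset.sum_sub_distrib, ← Finset.mul_sum, sub_div]
  rw [Finset.sum_comm, mul_div_assoc, Finset.sum_div Finset.univ (fun q => ∑ p, _),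
    Finset.sum_congr rfl fun q _ => havg q]
  rw [Finset.sum_const, Finset.sum_const, Finset.card_univ, Finset.card_univ, Fintype.card_fin,
    nsmul_eq_mul, nsmul_eq_mul, mul_div_cancel_left₀ _ hc, ← mul_assoc,
    one_div_mul_cancel hPR, one_mul]

/-- Maximal deviation bound for the subsampled minibatch estimator: with `n` iid
samples from each of `α, β`, `k` uniformly drawn minibatch pairs of size `m`, and a
kernel `h` with values in `[0,M]`, with probability at least `1 − δ`,
`|h̃_k^m(X,Y) − E_h| ≤ M(√(log(2/δ)/(2⌊n/m⌋)) + √(2 log(2/δ)/k))`. -/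
theorem minibatch_maximal_deviation
    {E F : Type*} [MeasurableSpace E] [MeasurableSpace F]
    (α : Measure E) (β : Measure F)
    [IsProbabilityMeasure α] [IsProbabilityMeasure β]
    (n m k : ℕ) (hm : 1 ≤ m) (hmn : m ≤ n) (hk : 1 ≤ k)
    [Nonempty (Fin m ↪ Fin n)]
    (h : (Fin m → E) → (Fin m → F) → ℝ) (M : ℝ)
    (hmeas : Measurable (Function.uncurry h))
    (hbd : ∀ x y, 0 ≤ h x y ∧ h x y ≤ M)
    (Eh : ℝ)
    (hEh : Eh = ∫ z, h z.1 z.2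
        ∂((Measure.pi fun _ : Fin m => α).prod (Measure.pi fun _ : Fin m => β)))
    (δ : ℝ) (hδ0 : 0 < δ) (hδ1 : δ < 1) :
    1 - δ ≤
      ((((Measure.pi fun _ : Fin n => α).prod (Measure.pi fun _ : Fin n => β)).prod
          (Measure.pi fun _ : Fin k =>
            (PMF.uniformOfFintype ((Fin m ↪ Fin n) × (Fin m ↪ Fin n))).toMeasure))
        {ω : ((Fin n → E) × (Fin n → F)) × (Fin k → (Fin m ↪ Fin n) × (Fin m ↪ Fin n)) |
          |(1 / k : ℝ) * (∑ l, h (fun i => ω.1.1 ((ω.2 l).1 i)) (fun j => ω.1.2 ((ω.2 l).2 j)))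
              - Eh|
            ≤ M * (Real.sqrt (Real.log (2 / δ) / (2 * (n / m : ℕ)))
                + Real.sqrt (2 * Real.log (2 / δ) / k))}).toReal := by
  obtain ⟨x₀⟩ : Nonempty E := nonempty_of_isProbabilityMeasure α
  obtain ⟨y₀⟩ : Nonempty F := nonempty_of_isProbabilityMeasure β
  have hM : 0 ≤ M := (hbd (fun _ => x₀) fun _ => y₀).1.trans (hbd _ _).2
  lift M to NNReal using hM
  have hP : 0 < n / m := Nat.div_pos hmn hm
  have hPR : (0 : ℝ) < (n / m : ℕ) := by exact_mod_cast hP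
  have hkR : (0 : ℝ) < k := by exact_mod_cast hk
  have : Nonempty (Fin k) := ⟨⟨0, hk⟩⟩
  have : DiscreteMeasurableSpace (Fin m ↪ Fin n) := ⟨fun _ => trivial⟩
  have hU := hasSubgaussianMGF_completeUStatistic α β hm hmn hmeas hbd
  rw [← hEh] at hU
  let G : (Fin n → E) × (Fin n → F) → (Fin m ↪ Fin n) × (Fin m ↪ Fin n) → ℝ := fun ω z =>
    h (fun i => ω.1 (z.1 i)) (fun j => ω.2 (z.2 j))
  have hGm : Measurable (Function.uncurry G) := by
    refine measurable_from_prod_countable_left fun z => ?_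
    exact hmeas.comp (f := fun ω : (Fin n → E) × (Fin n → F) =>
      (fun i => ω.1 (z.1 i), fun j => ω.2 (z.2 j))) (by fun_prop)
  have hGint : ∀ ω, ∫ z, G ω z
        ∂(PMF.uniformOfFintype ((Fin m ↪ Fin n) × (Fin m ↪ Fin n))).toMeasure =
      (∑ z, G ω z) / Fintype.card ((Fin m ↪ Fin n) × (Fin m ↪ Fin n)) := by
    intro ω
    rw [PMF.integral_eq_sum]
    simp only [PMF.uniformOfFintype_apply, ENNReal.toReal_inv, ENNReal.toReal_natCast,
      smul_eq_mul, ← Finset.mul_sum]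
    rw [inv_mul_eq_div]
  have hS := ProbabilityTheory.HasSubgaussianMGF.resample (ι := Fin k) (c := M ^ 2 / (4 * (n / m : ℕ))) (e := Eh)
    (P := (Measure.pi fun _ : Fin n => α).prod (Measure.pi fun _ : Fin n => β))
    (ν := (PMF.uniformOfFintype ((Fin m ↪ Fin n) × (Fin m ↪ Fin n))).toMeasure)
    hGm (fun ω z => hbd _ _) (by simpa only [hGint] using hU)
  rw [Fintype.card_fin] at hS
  set μ := ((Measure.pi fun _ : Fin n => α).prod (Measure.pi fun _ : Fin n => β)).prod
    (Measure.pi fun _ : Fin k =>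
      (PMF.uniformOfFintype ((Fin m ↪ Fin n) × (Fin m ↪ Fin n))).toMeasure)
  set L := Real.log (2 / δ)
  have hL : 0 < L := Real.log_pos (by rw [lt_div_iff₀ hδ0]; linarith)
  set ε := (M : ℝ) * (Real.sqrt (L / (2 * (n / m : ℕ))) + Real.sqrt (2 * L / k)) with hε
  have hε0 : 0 ≤ ε := by positivity
  have hmS : Measurable (fun ω : ((Fin n → E) × (Fin n → F)) ×
      (Fin k → (Fin m ↪ Fin n) × (Fin m ↪ Fin n)) =>
      1 / (k : ℝ) * ∑ l, G ω.1 (ω.2 l) - Eh) := by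
    refine ((Finset.measurable_fun_sum _ fun l _ => ?_).const_mul _).sub_const _
    exact hGm.comp (measurable_fst.prodMk ((measurable_pi_apply l).comp measurable_snd))
  rcases eq_or_ne M 0 with rfl | hM0
  · have h0 : ∀ x y, h x y = 0 := fun x y => le_antisymm (hbd x y).2 (hbd x y).1
    have hE0 : Eh = 0 := by simp [hEh, h0]
    simp [h0, hE0, hε, hδ0.le]
  have hMpos : (0 : ℝ) < M := by positivity
  have htail : μ.real {ω | ε ≤ |1 / (k : ℝ) * ∑ l, G ω.1 (ω.2 l) - Eh|} ≤ δ := by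
    refine (hS.measure_abs_ge_le hε0).trans ?_
    have hsq : (M : ℝ) ^ 2 * (L / (2 * (n / m : ℕ)) + 2 * L / k) ≤ ε ^ 2 := by
      have h1 := Real.sq_sqrt (show 0 ≤ L / (2 * ((n / m : ℕ) : ℝ)) by positivity)
      have h2 := Real.sq_sqrt (show 0 ≤ 2 * L / (k : ℝ) by positivity)
      rw [hε, mul_pow]
      gcongr
      nlinarith [mul_nonneg (Real.sqrt_nonneg (L / (2 * ((n / m : ℕ) : ℝ))))
        (Real.sqrt_nonneg (2 * L / (k : ℝ)))]
    have hexp : -ε ^ 2 / (2 * ((M ^ 2 / (4 * (n / m : ℕ)) + M ^ 2 / (4 * k) : NNReal) : ℝ))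
        ≤ -L := by
      push_cast
      rw [neg_div, neg_le_neg_iff, le_div_iff₀ (by positivity)]
      refine le_trans ?_ hsq
      have h3 : L * (2 * ((M : ℝ) ^ 2 / (4 * (n / m : ℕ)) + (M : ℝ) ^ 2 / (4 * k))) =
          (M : ℝ) ^ 2 * (L / (2 * (n / m : ℕ)) + L / k / 2) := by
        field_simp
        ring
      rw [h3, mul_div_assoc 2 L]
      refine mul_le_mul_of_nonneg_left (add_le_add_right ?_ _) (sq_nonneg _)
      linarith [div_pos hL hkR]
    calc 2 * Real.exp _ ≤ 2 * Real.exp (-L) := by gcongr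
      _ = δ := by
        rw [Real.exp_neg, Real.exp_log (by positivity)]
        field_simp
  change 1 - δ ≤ μ.real {ω | |1 / (k : ℝ) * ∑ l, G ω.1 (ω.2 l) - Eh| ≤ ε}
  have hcompl := probReal_compl_eq_one_sub (μ := μ)
    (measurableSet_le hmS.abs (measurable_const (a := ε)))
  have hmono : μ.real {ω | |1 / (k : ℝ) * ∑ l, G ω.1 (ω.2 l) - Eh| ≤ ε}ᶜ ≤ δ := by
    refine (measureReal_mono fun ω hω => ?_).trans htail
    simp only [Set.mem_compl_iff, Set.mem_ofPred_eq, not_le] at hω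
    exact hω.le
  linarith
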